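/- arXiv:2412.11451 — 2 statements merged into one kernel-verified Lean document; each statement's English description precedes it below -/
import Mathlib

section
/- Let d, N ∈ ℕ with d, N ≥ 1 and let δ ∈ (0,1). Let X and Y be measurable spaces and P a probability measure on X × Y. Let Θ ⊆ ℝ^d be nonempty and compact, and let 𝔉 : Θ → Matrix(Fin d, Fin d, ℝ) assign to each θ a symmetric positive-definite matrix with eigenvalues λ_1(θ) ≥ λ_2(θ) ≥ … ≥ λ_d(θ) > 0. For a threshold α > 0, define the effective dimension d_eff(α) = max{r ∈ {1,…,d} : λ_r(θ) ≥ α for all θ ∈ Θ}, and assume this maximum exists. Let Θ_loc ⊆ Θ be a nonempty compact local region, let f : Θ → X → ℝ be such that (θ, x) ↦ f_θ(x) is jointly measurable with f_θ(x) ∈ [0,1], and let ℓ : Y × ℝ → [0,1] be measurable and, for each y ∈ Y, Lipschitz in its second argument with constant L ≤ 1. Suppose there exists C_loc ≥ 0 such that the empirical function-class covering numbers induced by Θ_loc satisfy log N(ε, {x ↦ f_θ(x) : θ ∈ Θ_loc}, ‖·‖_{2,D}) ≤ C_loc − d_eff(α)·log ε for all ε ∈ (0,1] and every sample D of size N (reflecting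 that only d_eff(α) parameter directions exceed the threshold α). Then, with probability at least 1 − δ over an i.i.d. sample D = ((x_1,y_1),…,(x_N,y_N)) drawn from P^⊗N, for all θ ∈ Θ_loc: R(θ) ≤ R̂_N(θ; D) + 12·√(π·d_eff(α))·exp(C_loc/d_eff(α))/√N + 3·√(log(2/δ)/(2N)). -/
open MeasureTheory

/-- The ε-covering number of a set `S` with respect to a distance function `ρ`. -/
noncomputable def covN {α : Type*} (ρ : α → α → ℝ) (ε : ℝ) (S : Set α) : ℕ∞ :=
  sInf {k : ℕ∞ | ∃ T : Finset α, (T.card : ℕ∞) = k ∧ ∀ s ∈ S, ∃ c ∈ T, ρ s c ≤ ε}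

/-- The empirical L2 seminorm distance on functions `X → ℝ`, induced by sample
points `xs 0, …, xs (N-1)`. -/
noncomputable def empDist {X : Type*} {N : ℕ} (xs : Fin N → X) (g h : X → ℝ) : ℝ :=
  Real.sqrt ((1 / (N : ℝ)) * ∑ i, (g (xs i) - h (xs i)) ^ 2)


/-- universally measurable real function -/
def UMeas {Ω : Type*} [MeasurableSpace Ω] (g : Ω → ℝ) : Prop :=
  ∀ μ : Measure Ω, IsFiniteMeasure μ → AEMeasurable g μ

lemma exists_cantor_code {E Ω : Type*} [MeasurableSpace E] [MeasurableSpace Ω]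
    (B : Set (E × Ω)) (hB : MeasurableSet B) :
    ∃ ψ : Ω → ℕ → Bool, Measurable ψ ∧ ∃ B' : Set (E × (ℕ → Bool)), MeasurableSet B' ∧
      B = (fun p : E × Ω => (p.1, ψ p.2)) ⁻¹' B' := by
  classical
  have key : (inferInstance : MeasurableSpace (E × Ω)) = _ := generateFrom_prod.symm
  induction B, hB using MeasurableSpace.induction_on_inter key isPiSystem_prod with
  | empty => exact ⟨fun _ _ => true, measurable_const, ∅, MeasurableSet.empty, by simp⟩
  | basic t ht =>
    obtain ⟨s, hs, u, hu, rfl⟩ := ht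
    refine ⟨fun ω _ => decide (ω ∈ u), ?_, s ×ˢ {b | b 0 = true}, ?_, ?_⟩
    · refine measurable_pi_lambda _ fun _ => ?_
      exact measurable_to_bool (by simpa [Set.preimage] using hu)
    · refine hs.prod ?_
      exact measurableSet_eq_fun (measurable_pi_apply 0) measurable_const
    · ext p; simp
  | compl t ht ih =>
    obtain ⟨ψ, hψ, B', hB', rfl⟩ := ih
    exact ⟨ψ, hψ, B'ᶜ, hB'.compl, rfl⟩
  | iUnion f hd hf ih =>
    choose ψ hψ B' hB' h using ih
    refine ⟨fun ω k => ψ k.unpair.1 ω k.unpair.2, ?_,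
      ⋃ n, (fun p : E × (ℕ → Bool) => (p.1, fun k => p.2 (Nat.pair n k))) ⁻¹' B' n, ?_, ?_⟩
    · refine measurable_pi_lambda _ fun k => ?_
      exact (measurable_pi_apply _).comp (hψ _)
    · refine MeasurableSet.iUnion fun n => ?_
      refine measurableSet_preimage ?_ (hB' n)
      fun_prop
    · rw [Set.preimage_iUnion]
      refine Set.iUnion_congr fun n => ?_
      conv_lhs => rw [h n]
      ext p; simp

lemma exists_compact_of_lt {Z : Type*} [TopologicalSpace Z] [MeasurableSpace Z]
    [BorelSpace Z] (μ : Measure Z) [μ.OuterRegular]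
    (g : (ℕ → ℕ) → Z) (hg : Continuous g) (c : ENNReal) (hc : c < μ (Set.range g)) :
    ∃ K ⊆ Set.range g, IsCompact K ∧ c ≤ μ K := by
  have step : ∀ (k : ℕ) (S : Set (ℕ → ℕ)), ∃ m : ℕ, c < μ (g '' S) →
      c < μ (g '' (S ∩ {x | x k ≤ m})) := by
    intro k S
    by_cases h : c < μ (g '' S)
    swap
    · exact ⟨0, fun h' => absurd h' h⟩
    have : g '' S = ⋃ m, g '' (S ∩ {x | x k ≤ m}) := by
      rw [← Set.image_iUnion, ← Set.inter_iUnion]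
      congr 1
      ext x
      simp only [Set.mem_inter_iff, Set.mem_iUnion, Set.mem_ofPred_eq]
      exact ⟨fun hx => ⟨hx, _, le_rfl⟩, fun hx => hx.1⟩
    rw [this, Monotone.measure_iUnion] at h
    · obtain ⟨m, hm⟩ := lt_iSup_iff.1 h
      exact ⟨m, fun _ => hm⟩
    · intro a b hab
      refine Set.image_mono (Set.inter_subset_inter_right _ ?_)
      intro x hx
      exact le_trans (show x k ≤ a from hx) hab
  choose m hm using step
  let S : ℕ → Set (ℕ → ℕ) := fun k => Nat.rec Set.univ (fun k S => S ∩ {x | x k ≤ m k S}) k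
  have hS1 : ∀ k, S (k+1) = S k ∩ {x | x k ≤ m k (S k)} := fun k => rfl
  have hSc : ∀ k, c < μ (g '' S k) := by
    intro k
    induction k with
    | zero => simpa [S] using hc
    | succ k ih => rw [hS1]; exact hm _ _ ih
  let n : ℕ → ℕ := fun k => m k (S k)
  have hSn : ∀ k, ∀ x ∈ S k, ∀ i < k, x i ≤ n i := by
    intro k
    induction k with
    | zero => intro x _ i hi; omega
    | succ k ih =>
      intro x hx i hi
      rw [hS1] at hx
      rcases Nat.lt_succ_iff_lt_or_eq.1 hi with h | rfl
      · exact ih x hx.1 i h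
      · exact hx.2
  let Lc : Set (ℕ → ℕ) := Set.univ.pi fun i => Set.Iic (n i)
  have hL : IsCompact Lc := isCompact_univ_pi fun i => (Set.finite_Iic _).isCompact
  refine ⟨g '' Lc, Set.image_subset_range _ _, hL.image hg, ?_⟩
  rw [Set.measure_eq_iInf_isOpen]
  refine le_iInf fun U => le_iInf fun hU => le_iInf fun hUo => ?_
  have : ∃ k, S k ⊆ g ⁻¹' U := by
    by_contra! hcon
    have hcon' : ∀ k, ∃ x ∈ S k, x ∉ g ⁻¹' U := fun k => Set.not_subset.1 (hcon k)
    choose x hx hxU using hcon'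
    let y : ℕ → ℕ → ℕ := fun k i => min (x k i) (n i)
    have hy : ∀ k, y k ∈ Lc := fun k i _ => Set.mem_Iic.2 (min_le_right _ _)
    obtain ⟨z, hz, φ, hφ, hlim⟩ := hL.tendsto_subseq hy
    have hlim' : Filter.Tendsto (x ∘ φ) Filter.atTop (nhds z) := by
      rw [tendsto_pi_nhds] at hlim ⊢
      intro i
      refine (hlim i).congr' ?_
      filter_upwards [Filter.eventually_gt_atTop i] with k hk
      have : i < φ k := lt_of_lt_of_le hk (hφ.id_le k)
      simp only [Function.comp, y]
      exact min_eq_left (hSn _ _ (hx _) i this)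
    have hcl : IsClosed (g ⁻¹' U)ᶜ := (hUo.preimage hg).isClosed_compl
    have hzV := hcl.mem_of_tendsto hlim' (Filter.Eventually.of_forall fun k => hxU (φ k))
    exact hzV (hU ⟨z, hz, rfl⟩)
  obtain ⟨k, hk⟩ := this
  exact (hSc k).le.trans (measure_mono (Set.image_subset_iff.2 hk))

lemma analytic_nullMeasurable {Z : Type*} [TopologicalSpace Z] [T2Space Z] [MeasurableSpace Z]
    [BorelSpace Z] (μ : Measure Z) [IsFiniteMeasure μ] [μ.OuterRegular]
    (A : Set Z) (hA : AnalyticSet A) : NullMeasurableSet A μ := by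
  rw [AnalyticSet] at hA
  rcases hA with rfl | ⟨g, hg, rfl⟩
  · exact nullMeasurableSet_empty
  by_cases h0 : μ (Set.range g) = 0
  · exact NullMeasurableSet.of_null h0
  obtain ⟨u, -, hu, hut⟩ := exists_seq_strictMono_tendsto' (pos_iff_ne_zero.2 h0)
  have : ∀ k, ∃ K ⊆ Set.range g, IsCompact K ∧ u k ≤ μ K := fun k =>
    exists_compact_of_lt μ g hg (u k) (hu k).2
  choose K hKs hKc hK using this
  have hm : MeasurableSet (⋃ k, K k) := MeasurableSet.iUnion fun k => (hKc k).measurableSet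
  refine NullMeasurableSet.congr hm.nullMeasurableSet ?_
  refine ae_eq_of_subset_of_measure_ge (Set.iUnion_subset hKs) ?_ hm.nullMeasurableSet
    (measure_ne_top _ _)
  refine le_of_tendsto' hut fun k => (hK k).trans (measure_mono (Set.subset_iUnion _ _))

lemma proj_nullMeasurable {E Ω : Type*} [TopologicalSpace E] [PolishSpace E]
    [MeasurableSpace E] [BorelSpace E] [MeasurableSpace Ω]
    (B : Set (E × Ω)) (hB : MeasurableSet B) (μ : Measure Ω) [IsFiniteMeasure μ] :
    NullMeasurableSet {ω | ∃ e, (e, ω) ∈ B} μ := by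
  obtain ⟨ψ, hψ, B', hB', rfl⟩ := exists_cantor_code B hB
  have h1 : AnalyticSet (Prod.snd '' B') := hB'.analyticSet_image measurable_snd
  have h2 := analytic_nullMeasurable (μ.map ψ) _ h1
  have h3 := h2.preimage (hψ.measurePreserving μ).quasiMeasurePreserving
  convert h3 using 1
  ext ω
  simp

lemma umeas_iSup {E Ω : Type*} [TopologicalSpace E] [PolishSpace E]
    [MeasurableSpace E] [BorelSpace E] [MeasurableSpace Ω] [Nonempty E]
    (F : E × Ω → ℝ) (hF : Measurable F) (M : ℝ) (hM : ∀ p, |F p| ≤ M) :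
    UMeas (fun ω => ⨆ e, F (e, ω)) := by
  intro μ _
  refine NullMeasurable.aemeasurable ?_
  have : @Measurable (NullMeasurableSpace Ω μ) ℝ _ _ (fun ω => ⨆ e, F (e, ω)) := by
    refine measurable_of_Ioi fun t => ?_
    have h := proj_nullMeasurable {p : E × Ω | t < F p} (measurableSet_lt measurable_const hF) μ
    suffices hh : ((fun ω : Ω => ⨆ e, F (e, ω)) ⁻¹' Set.Ioi t) =
        {ω : Ω | ∃ e, (e, ω) ∈ {p : E × Ω | t < F p}} by
      rw [← hh] at h
      exact h
    ext ω
    simp only [Set.mem_preimage, Set.mem_Ioi, Set.mem_ofPred_eq]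
    refine lt_ciSup_iff ⟨M, ?_⟩
    rintro _ ⟨e, rfl⟩
    exact (abs_le.1 (hM _)).2
  exact this
lemma UMeas.comp {Ω Ω' : Type*} [MeasurableSpace Ω] [MeasurableSpace Ω'] {g : Ω → ℝ}
    (hg : UMeas g) {e : Ω' → Ω} (he : Measurable e) : UMeas (fun x => g (e x)) := by
  intro μ _
  exact (hg (μ.map e) inferInstance).comp_measurable he

lemma UMeas.integrable {Ω : Type*} [MeasurableSpace Ω] {g : Ω → ℝ}
    (hg : UMeas g) {M : ℝ} (hM : ∀ x, |g x| ≤ M) (μ : Measure Ω) [IsFiniteMeasure μ] :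
    Integrable g μ :=
  Integrable.of_bound (hg μ inferInstance).aestronglyMeasurable M
    (Filter.Eventually.of_forall fun x => by simpa using hM x)

lemma hoeffding_range {Z : Type*} [MeasurableSpace Z] (P : Measure Z) [IsProbabilityMeasure P]
    (g : Z → ℝ) (hg : AEMeasurable g P) (c : ℝ) (hc : 0 ≤ c)
    (h : ∀ x y, |g x - g y| ≤ c) (t : ℝ) :
    ∫ z, Real.exp (t * (g z - ∫ w, g w ∂P)) ∂P ≤ Real.exp (t ^ 2 * c ^ 2 / 8) := by
  have hne : Nonempty Z := by
    by_contra hcon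
    rw [not_nonempty_iff] at hcon
    have : P Set.univ = 0 := by rw [Set.univ_eq_empty_iff.2 hcon]; simp
    simp at this
  obtain ⟨z0⟩ := hne
  have hbdd : BddBelow (Set.range g) := by
    refine ⟨g z0 - c, ?_⟩
    rintro _ ⟨x, rfl⟩
    have := (abs_le.1 (h z0 x)).2
    linarith
  have hmem : ∀ x, g x ∈ Set.Icc (⨅ z, g z) ((⨅ z, g z) + c) := by
    intro x
    have : Nonempty Z := ⟨z0⟩
    refine ⟨ciInf_le hbdd x, ?_⟩
    have : g x - c ≤ ⨅ z, g z := le_ciInf fun z => by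
      have := (abs_le.1 (h x z)).2
      linarith
    linarith
  have := (ProbabilityTheory.hasSubgaussianMGF_of_mem_Icc hg
    (Filter.Eventually.of_forall hmem)).mgf_le t
  rw [ProbabilityTheory.mgf] at this
  refine this.trans (le_of_eq ?_)
  congr 1
  simp only [add_sub_cancel_left, NNReal.coe_pow, NNReal.coe_div, coe_nnnorm, Real.norm_eq_abs,
    NNReal.coe_ofNat, abs_of_nonneg hc]
  ring

lemma mcdiarmid_mgf {Z : Type*} [MeasurableSpace Z] (P : Measure Z) [IsProbabilityMeasure P]
    (c : ℝ) (hc : 0 ≤ c) (t : ℝ) (M : ℝ) : ∀ (n : ℕ) (g : (Fin n → Z) → ℝ), UMeas g →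
    (∀ x, |g x| ≤ M) → (∀ x i z, |g (Function.update x i z) - g x| ≤ c) →
    ∫ x, Real.exp (t * (g x - ∫ w, g w ∂Measure.pi fun _ => P)) ∂(Measure.pi fun _ => P)
      ≤ Real.exp (n * (t ^ 2 * c ^ 2 / 8)) := by
  intro n
  induction n with
  | zero =>
    intro g _ _ _
    have : ∀ x y : Fin 0 → Z, g x = g y := fun x y => by rw [Subsingleton.elim x y]
    have h0 : g = fun _ => g Fin.elim0 := funext fun x => this x _
    rw [h0]
    simp
  | succ n ih =>
    intro g hg hM hgc
    have hcm : Measurable fun p : Z × (Fin n → Z) => (Fin.cons p.1 p.2 : Fin (n+1) → Z) := by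
      refine measurable_pi_lambda _ fun i => ?_
      refine Fin.cases ?_ (fun j => ?_) i
      · simpa using measurable_fst
      · simp only [Fin.cons_succ]; fun_prop
    let G : Z × (Fin n → Z) → ℝ := fun p => g (Fin.cons p.1 p.2)
    have hG : UMeas G := hg.comp hcm
    have hGM : ∀ p, |G p| ≤ M := fun p => hM _
    let H : (Fin n → Z) → ℝ := fun r => ∫ z, G (z, r) ∂P
    have hint : ∀ φ : (Fin (n+1) → Z) → ℝ, ∫ x, φ x ∂(Measure.pi fun _ => P) =
        ∫ p : Z × (Fin n → Z), φ (Fin.cons p.1 p.2) ∂(P.prod (Measure.pi fun _ => P)) := by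
      intro φ
      have := ((measurePreserving_piFinSuccAbove (fun _ : Fin (n+1) => P) 0).symm)
      rw [← this.integral_comp']
      simp_rw [MeasurableEquiv.piFinSuccAbove_symm_apply, Fin.insertNthEquiv,
        Fin.insertNth_zero]
      rfl
    have hsl : ∀ r, UMeas fun z => G (z, r) := fun r => hG.comp (by fun_prop)
    have hHu : UMeas H := by
      intro ν _
      have h1 : AEStronglyMeasurable G (P.prod ν) :=
        (hG (P.prod ν) inferInstance).aestronglyMeasurable
      exact (h1.prod_swap.integral_prod_right').aemeasurable
    have hHM : ∀ r, |H r| ≤ M := by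
      intro r
      have := norm_integral_le_of_norm_le_const (μ := P) (f := fun z => G (z, r)) (C := M)
        (Filter.Eventually.of_forall fun z => by simpa using hGM (z, r))
      simpa using this
    have hHc : ∀ x i z, |H (Function.update x i z) - H x| ≤ c := by
      intro x i z
      simp only [H]
      rw [← integral_sub ((hsl _).integrable (fun z => hGM _) P)
        ((hsl _).integrable (fun z => hGM _) P)]
      have := norm_integral_le_of_norm_le_const (μ := P)
        (f := fun w => G (w, Function.update x i z) - G (w, x)) (C := c)
        (Filter.Eventually.of_forall fun w => by
          have := hgc (Fin.cons w x) i.succ z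
          rw [← Fin.cons_update] at this
          exact this)
      simpa using this
    have hEG : ∫ w, g w ∂(Measure.pi fun _ => P) = ∫ r, H r ∂(Measure.pi fun _ => P) := by
      rw [hint g]
      exact integral_prod_symm _ (hG.integrable hGM _)
    set m := ∫ w, g w ∂(Measure.pi fun _ => P) with hm
    have hexpb : ∀ a : ℝ, |a| ≤ M → ‖Real.exp (t * (a - m))‖ ≤ Real.exp (|t| * (M + |m|)) := by
      intro a ha
      rw [Real.norm_eq_abs, abs_of_pos (Real.exp_pos _)]
      refine Real.exp_le_exp.2 ((le_abs_self _).trans ?_)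
      rw [abs_mul]
      exact mul_le_mul_of_nonneg_left ((abs_sub _ _).trans (by linarith)) (abs_nonneg _)
    have hexpm : Measurable fun a : ℝ => Real.exp (t * (a - m)) := by fun_prop
    have hI1 : Integrable (fun p : Z × (Fin n → Z) => Real.exp (t * (G p - m)))
        (P.prod (Measure.pi fun _ => P)) :=
      Integrable.of_bound (hexpm.comp_aemeasurable (hG _ inferInstance)).aestronglyMeasurable _
        (Filter.Eventually.of_forall fun p => hexpb _ (hGM p))
    have hI2 : Integrable (fun r : (Fin n → Z) => Real.exp (t * (H r - m)))
        (Measure.pi fun _ => P) :=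
      Integrable.of_bound (hexpm.comp_aemeasurable (hHu _ inferInstance)).aestronglyMeasurable _
        (Filter.Eventually.of_forall fun p => hexpb _ (hHM p))
    rw [hint]
    change ∫ p : Z × (Fin n → Z), Real.exp (t * (G p - m)) ∂_ ≤ _
    rw [integral_prod_symm _ hI1]
    calc ∫ r, ∫ z, Real.exp (t * (G (z, r) - m)) ∂P ∂(Measure.pi fun _ => P)
        ≤ ∫ r, Real.exp (t * (H r - m)) * Real.exp (t ^ 2 * c ^ 2 / 8)
            ∂(Measure.pi fun _ => P) := by
          refine integral_mono hI1.integral_prod_right (hI2.mul_const _) fun r => ?_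
          have h1 := hoeffding_range P (fun z => G (z, r)) (hsl r P inferInstance) c hc
            (fun x y => by
              have := hgc (Fin.cons y r) 0 x
              rw [Fin.update_cons_zero] at this
              exact this) t
          have h2 : ∀ z, Real.exp (t * (G (z, r) - m)) =
              Real.exp (t * (H r - m)) * Real.exp (t * (G (z, r) - H r)) := by
            intro z; rw [← Real.exp_add]; congr 1; ring
          simp_rw [h2]
          rw [integral_const_mul]
          exact mul_le_mul_of_nonneg_left h1 (Real.exp_pos _).le
      _ = (∫ r, Real.exp (t * (H r - m)) ∂(Measure.pi fun _ => P))
            * Real.exp (t ^ 2 * c ^ 2 / 8) := integral_mul_const _ _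
      _ ≤ Real.exp (n * (t ^ 2 * c ^ 2 / 8)) * Real.exp (t ^ 2 * c ^ 2 / 8) := by
          refine mul_le_mul_of_nonneg_right ?_ (Real.exp_pos _).le
          rw [hEG]
          exact ih H hHu hHM hHc
      _ = Real.exp ((n + 1 : ℕ) * (t ^ 2 * c ^ 2 / 8)) := by
          rw [← Real.exp_add]; congr 1; push_cast; ring

/-- McDiarmid with differences `1/N`. -/
lemma mcdiarmid_tail {Z : Type*} [MeasurableSpace Z] (P : Measure Z) [IsProbabilityMeasure P]
    {N : ℕ} (hN : 1 ≤ N) (g : (Fin N → Z) → ℝ) (hg : UMeas g) (M : ℝ)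
    (hM : ∀ x, |g x| ≤ M) (hgc : ∀ x i z, |g (Function.update x i z) - g x| ≤ 1 / (N : ℝ))
    (s : ℝ) (hs : 0 ≤ s) :
    (Measure.pi fun _ => P).real
      {x | s ≤ g x - ∫ w, g w ∂(Measure.pi fun _ => P)} ≤ Real.exp (- 2 * N * s ^ 2) := by
  have hN0 : (0 : ℝ) < N := by exact_mod_cast hN
  set m := ∫ w, g w ∂(Measure.pi fun _ => P) with hm
  have ht : 0 ≤ 4 * (N : ℝ) * s := by positivity
  have hI : Integrable (fun x => Real.exp (4 * N * s * (g x - m))) (Measure.pi fun _ => P) := by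
    refine Integrable.of_bound ?_ (Real.exp (|4 * N * s| * (M + |m|))) ?_
    · exact (Measurable.comp_aemeasurable (by fun_prop : Measurable fun a : ℝ =>
        Real.exp (4 * N * s * (a - m))) (hg _ inferInstance)).aestronglyMeasurable
    · refine Filter.Eventually.of_forall fun x => ?_
      rw [Real.norm_eq_abs, abs_of_pos (Real.exp_pos _)]
      refine Real.exp_le_exp.2 ((le_abs_self _).trans ?_)
      rw [abs_mul]
      exact mul_le_mul_of_nonneg_left ((abs_sub _ _).trans (by linarith [hM x])) (abs_nonneg _)
  have h1 := ProbabilityTheory.measure_ge_le_exp_mul_mgf (μ := Measure.pi fun _ : Fin N => P)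
    (X := fun x => g x - m) s ht hI
  have h2 := mcdiarmid_mgf P (1 / (N : ℝ)) (by positivity) (4 * N * s) M N g hg hM hgc
  refine h1.trans ?_
  rw [ProbabilityTheory.mgf]
  refine (mul_le_mul_of_nonneg_left h2 (Real.exp_pos _).le).trans (le_of_eq ?_)
  rw [← Real.exp_add]
  congr 1
  field_simp
  ring

/-- sign of a boolean -/
def bsgn (b : Bool) : ℝ := if b then 1 else -1

lemma bsgn_abs (b : Bool) : |bsgn b| = 1 := by cases b <;> simp [bsgn]

lemma rad_mgf {N : ℕ} (w : Fin N → ℝ) (t : ℝ) :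
    ∑ σ : Fin N → Bool, Real.exp (t * ∑ i, bsgn (σ i) * w i)
      ≤ 2 ^ N * Real.exp (t ^ 2 * (∑ i, w i ^ 2) / 2) := by
  have h1 : ∀ σ : Fin N → Bool, Real.exp (t * ∑ i, bsgn (σ i) * w i) =
      ∏ i, Real.exp (t * (bsgn (σ i) * w i)) := by
    intro σ
    rw [Finset.mul_sum, Real.exp_sum]
  simp_rw [h1]
  have h2 := Finset.prod_univ_sum (fun _ : Fin N => (Finset.univ : Finset Bool))
    (fun i b => Real.exp (t * (bsgn b * w i)))
  rw [Fintype.piFinset_univ] at h2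
  rw [← h2]
  have h3 : ∀ i : Fin N, ∑ b : Bool, Real.exp (t * (bsgn b * w i)) ≤
      2 * Real.exp ((t * w i) ^ 2 / 2) := by
    intro i
    have := Real.cosh_le_exp_half_sq (t * w i)
    rw [Real.cosh_eq] at this
    simp only [Fintype.sum_bool, bsgn, if_true, Bool.false_eq_true, if_false]
    have e1 : t * (1 * w i) = t * w i := by ring
    have e2 : t * (-1 * w i) = -(t * w i) := by ring
    rw [e1, e2]
    linarith
  refine (Finset.prod_le_prod (fun i _ => Finset.sum_nonneg fun b _ => (Real.exp_pos _).le)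
    fun i _ => h3 i).trans (le_of_eq ?_)
  rw [Finset.prod_mul_distrib, ← Real.exp_sum]
  simp only [Finset.prod_const, Finset.card_univ, Fintype.card_fin]
  congr 2
  rw [← Finset.sum_div, Finset.mul_sum]
  congr 1
  exact Finset.sum_congr rfl fun i _ => by ring

lemma massart {N : ℕ} (hN : 1 ≤ N) (W : Finset (Fin N → ℝ)) (hW : W.Nonempty) (r A t : ℝ)
    (ht : 0 < t) (hr : ∀ w ∈ W, ∑ i, w i ^ 2 ≤ r ^ 2 * N) (hA : (W.card : ℝ) ≤ Real.exp A) :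
    ∑ σ : Fin N → Bool, (W.sup' hW fun w => (1 / (N : ℝ)) * ∑ i, bsgn (σ i) * w i)
      ≤ 2 ^ N * (A / t + t * r ^ 2 / (2 * N)) := by
  have hN0 : (0 : ℝ) < N := by exact_mod_cast hN
  set M : (Fin N → Bool) → ℝ := fun σ =>
    W.sup' hW fun w => (1 / (N : ℝ)) * ∑ i, bsgn (σ i) * w i with hM
  set b : ℝ := A + t ^ 2 * r ^ 2 / (2 * N) with hb
  have h1 : ∑ σ, Real.exp (t * M σ) ≤ 2 ^ N * Real.exp b := by
    have h2 : ∀ σ, Real.exp (t * M σ) ≤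
        ∑ w ∈ W, Real.exp ((t / N) * ∑ i, bsgn (σ i) * w i) := by
      intro σ
      obtain ⟨w, hw, hwe⟩ := Finset.exists_mem_eq_sup' hW
        (fun w => (1 / (N : ℝ)) * ∑ i, bsgn (σ i) * w i)
      have : M σ = (1 / (N : ℝ)) * ∑ i, bsgn (σ i) * w i := hwe
      rw [this]
      have e : t * ((1 / (N : ℝ)) * ∑ i, bsgn (σ i) * w i)
          = (t / N) * ∑ i, bsgn (σ i) * w i := by ring
      rw [e]
      exact Finset.single_le_sum (f := fun w : Fin N → ℝ =>
        Real.exp ((t / N) * ∑ i, bsgn (σ i) * w i)) (fun _ _ => (Real.exp_pos _).le) hw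
    calc ∑ σ, Real.exp (t * M σ)
        ≤ ∑ σ : Fin N → Bool, ∑ w ∈ W, Real.exp ((t / N) * ∑ i, bsgn (σ i) * w i) :=
          Finset.sum_le_sum fun σ _ => h2 σ
      _ = ∑ w ∈ W, ∑ σ : Fin N → Bool, Real.exp ((t / N) * ∑ i, bsgn (σ i) * w i) :=
          Finset.sum_comm
      _ ≤ ∑ w ∈ W, 2 ^ N * Real.exp (t ^ 2 * r ^ 2 / (2 * N)) := by
          refine Finset.sum_le_sum fun w hw => (rad_mgf w (t / N)).trans ?_
          refine mul_le_mul_of_nonneg_left (Real.exp_le_exp.2 ?_) (by positivity)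
          calc (t / N) ^ 2 * (∑ i, w i ^ 2) / 2 ≤ (t / N) ^ 2 * (r ^ 2 * N) / 2 := by
                have := hr w hw
                gcongr
            _ = t ^ 2 * r ^ 2 / (2 * N) := by field_simp
      _ = (W.card : ℝ) * (2 ^ N * Real.exp (t ^ 2 * r ^ 2 / (2 * N))) := by
          rw [Finset.sum_const, nsmul_eq_mul]
      _ ≤ Real.exp A * (2 ^ N * Real.exp (t ^ 2 * r ^ 2 / (2 * N))) := by gcongr
      _ = 2 ^ N * Real.exp b := by rw [hb, Real.exp_add]; ring
  have h3 : ∀ σ, t * M σ ≤ (b - 1) + Real.exp (-b) * Real.exp (t * M σ) := by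
    intro σ
    have := Real.add_one_le_exp (-b + t * M σ)
    rw [Real.exp_add] at this
    linarith
  have h4 : ∑ σ, t * M σ ≤ 2 ^ N * b := by
    calc ∑ σ, t * M σ ≤ ∑ σ : Fin N → Bool, ((b - 1) + Real.exp (-b) * Real.exp (t * M σ)) :=
          Finset.sum_le_sum fun σ _ => h3 σ
      _ = 2 ^ N * (b - 1) + Real.exp (-b) * ∑ σ, Real.exp (t * M σ) := by
          rw [Finset.sum_add_distrib, ← Finset.mul_sum]
          simp
          ring
      _ ≤ 2 ^ N * (b - 1) + Real.exp (-b) * (2 ^ N * Real.exp b) := by gcongr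
      _ = 2 ^ N * b := by
          have : Real.exp (-b) * Real.exp b = 1 := by rw [← Real.exp_add]; simp
          linear_combination (2 ^ N : ℝ) * this
  rw [← Finset.mul_sum] at h4
  have h5 : 2 ^ N * (A / t + t * r ^ 2 / (2 * N)) = (2 ^ N * b) / t := by
    rw [hb]; field_simp
  rw [h5, le_div_iff₀ ht]
  linarith

lemma geo_sums (J : ℕ) : ∑ j ∈ Finset.range J, ((1 : ℝ) / 2) ^ (j + 1) ≤ 1 ∧
    ∑ j ∈ Finset.range J, ((j : ℝ) + 1) * ((1 : ℝ) / 2) ^ (j + 1) ≤ 2 := by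
  have h1 : ∑ j ∈ Finset.range J, ((1 : ℝ) / 2) ^ (j + 1) = 1 - (1 / 2) ^ J := by
    induction J with
    | zero => simp
    | succ J ih => rw [Finset.sum_range_succ, ih, pow_succ]; ring
  have h2 : ∑ j ∈ Finset.range J, ((j : ℝ) + 1) * ((1 : ℝ) / 2) ^ (j + 1)
      = 2 - (J + 2) * (1 / 2) ^ J := by
    clear h1
    induction J with
    | zero => simp
    | succ J ih => rw [Finset.sum_range_succ, ih, pow_succ]; push_cast; ring
  have : (0 : ℝ) < (1 / 2) ^ J := by positivity
  constructor
  · rw [h1]; linarith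
  · rw [h2]; nlinarith [(Nat.cast_nonneg J : (0 : ℝ) ≤ J)]

lemma dudley {N : ℕ} (hN : 1 ≤ N) {ι : Type*} [Nonempty ι] (V : ι → Fin N → ℝ)
    (hV : ∀ θ i, |V θ i| ≤ 1) (C : ℝ) (hC : 0 ≤ C) (d : ℕ) (hd : 1 ≤ d)
    (hcov : ∀ j : ℕ, ∃ T : Finset (Fin N → ℝ),
      (T.card : ℝ) ≤ Real.exp (C + d * (j * Real.log 2)) ∧
      ∀ θ, ∃ c ∈ T, ∑ i, (V θ i - c i) ^ 2 ≤ ((1 / 2 : ℝ) ^ j) ^ 2 * N) :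
    ∑ σ : Fin N → Bool, (⨆ θ, (1 / (N : ℝ)) * ∑ i, bsgn (σ i) * V θ i)
      ≤ 2 ^ N * (6 * Real.sqrt (Real.pi * d) * Real.exp (C / d) / Real.sqrt N) := by
  classical
  have hN0 : (0 : ℝ) < N := by exact_mod_cast hN
  have hd0 : (0 : ℝ) < d := by exact_mod_cast hd
  have hlog : 0 < Real.log 2 := Real.log_pos (by norm_num)
  have hcov' : ∃ T : ℕ → Finset (Fin N → ℝ), T 0 = {0} ∧ (∀ j,
      ((T j).card : ℝ) ≤ Real.exp (C + d * (j * Real.log 2)) ∧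
      ∀ θ, ∃ c ∈ T j, ∑ i, (V θ i - c i) ^ 2 ≤ ((1 / 2 : ℝ) ^ j) ^ 2 * N) := by
    choose T hT using hcov
    refine ⟨fun j => if j = 0 then {0} else T j, by simp, fun j => ?_⟩
    by_cases hj : j = 0
    · subst hj
      simp only [if_true, Finset.card_singleton]
      refine ⟨?_, fun θ => ⟨0, by simp, ?_⟩⟩
      · simpa using hC
      · have : ∀ i ∈ Finset.univ, (V θ i - (0 : Fin N → ℝ) i) ^ 2 ≤ 1 := by
          intro i _
          have := hV θ i
          rw [← sq_abs]
          simp only [Pi.zero_apply, sub_zero]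
          nlinarith [abs_nonneg (V θ i)]
        refine (Finset.sum_le_sum this).trans ?_
        simp
    · simp only [hj, if_false]
      exact hT j
  obtain ⟨T, hT0, hT⟩ := hcov'
  have hp : ∀ j θ, ∃ c ∈ T j, ∑ i, (V θ i - c i) ^ 2 ≤ ((1 / 2 : ℝ) ^ j) ^ 2 * N :=
    fun j => (hT j).2
  choose p hpT hp using hp
  have hp0 : ∀ θ, p 0 θ = 0 := fun θ => by
    have := hpT 0 θ
    rw [hT0] at this
    simpa using this
  let W : ℕ → Finset (Fin N → ℝ) := fun j =>
    ((T (j+1) ×ˢ T j).image (fun q => q.1 - q.2)).filter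
      (fun w => ∑ i, w i ^ 2 ≤ (3 * (1 / 2 : ℝ) ^ (j + 1)) ^ 2 * N)
  have hmem : ∀ j θ, p (j+1) θ - p j θ ∈ W j := by
    intro j θ
    refine Finset.mem_filter.2 ⟨Finset.mem_image.2 ⟨(p (j+1) θ, p j θ),
      Finset.mk_mem_product (hpT _ _) (hpT _ _), rfl⟩, ?_⟩
    have h1 := hp (j+1) θ
    have h2 := hp j θ
    have h3 : ∀ i ∈ Finset.univ, (p (j+1) θ - p j θ) i ^ 2 ≤
        3 * (V θ i - p (j+1) θ i) ^ 2 + 3 / 2 * (V θ i - p j θ i) ^ 2 := by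
      intro i _
      simp only [Pi.sub_apply]
      nlinarith [sq_nonneg (2 * (V θ i - p (j+1) θ i) + (V θ i - p j θ i) -
        2 * (V θ i - p j θ i) + 0), sq_nonneg (2 * (V θ i - p (j+1) θ i) + (V θ i - p j θ i))]
    refine (Finset.sum_le_sum h3).trans ?_
    rw [Finset.sum_add_distrib, ← Finset.mul_sum, ← Finset.mul_sum]
    rw [pow_succ (1 / 2 : ℝ) j] at h1 ⊢
    nlinarith
  have hWne : ∀ j, (W j).Nonempty := fun j => ⟨_, hmem j (Classical.arbitrary ι)⟩
  have hWcard : ∀ j, ((W j).card : ℝ) ≤ Real.exp (2 * (C + d * ((j + 1) * Real.log 2))) := by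
    intro j
    have h1 : (W j).card ≤ (T (j+1)).card * (T j).card :=
      (Finset.card_filter_le _ _).trans (Finset.card_image_le.trans (Finset.card_product _ _).le)
    have h2 : ((W j).card : ℝ) ≤ (T (j+1)).card * (T j).card := by exact_mod_cast h1
    refine h2.trans ?_
    have h3 := (hT (j+1)).1
    have h4 : ((T j).card : ℝ) ≤ Real.exp (C + d * ((j + 1) * Real.log 2)) := by
      refine (hT j).1.trans (Real.exp_le_exp.2 ?_)
      gcongr
      linarith
    push_cast at h3
    calc ((T (j+1)).card : ℝ) * (T j).card ≤ _ * _ :=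
          mul_le_mul h3 h4 (Nat.cast_nonneg _) (Real.exp_pos _).le
      _ = _ := by rw [← Real.exp_add]; congr 1; ring
  set s : ℝ := Real.sqrt Real.pi * Real.exp (C / d) with hs
  have hs0 : 0 < s := by positivity
  have hsd : 0 < Real.sqrt d := Real.sqrt_pos.2 hd0
  have hsN : 0 < Real.sqrt N := Real.sqrt_pos.2 hN0
  have hss : C / d + 2 * Real.log 2 ≤ s ^ 2 := by
    have e1 : s ^ 2 = Real.pi * Real.exp (2 * (C / d)) := by
      rw [hs, mul_pow, Real.sq_sqrt Real.pi_pos.le, ← Real.exp_nat_mul]; norm_num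
    have e2 := Real.add_one_le_exp (2 * (C / d))
    have e3 : 0 ≤ C / d := by positivity
    rw [e1]
    nlinarith [Real.pi_gt_three, Real.log_two_lt_d9]
  set κ : ℝ := 2 / 3 * Real.sqrt d * s with hκ
  have hκ0 : 0 < κ := by positivity
  let M : ℕ → (Fin N → Bool) → ℝ := fun j σ =>
    (W j).sup' (hWne j) fun w => (1 / (N : ℝ)) * ∑ i, bsgn (σ i) * w i
  have hMj : ∀ j, ∑ σ, M j σ ≤ 2 ^ N *
      ((2 * C / κ + 9 / 2 * κ) * (1 / 2) ^ (j + 1)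
        + 2 * d * Real.log 2 / κ * ((j + 1) * (1 / 2) ^ (j + 1))) / Real.sqrt N := by
    intro j
    have h := massart hN (W j) (hWne j) (3 * (1 / 2 : ℝ) ^ (j + 1)) _
      (κ * Real.sqrt N * 2 ^ (j + 1)) (by positivity)
      (fun w hw => (Finset.mem_filter.1 hw).2) (hWcard j)
    refine h.trans (le_of_eq ?_)
    have e1 : (N : ℝ) = Real.sqrt N * Real.sqrt N := (Real.mul_self_sqrt hN0.le).symm
    rw [mul_div_assoc ((2 : ℝ) ^ N)]
    congr 1
    have e2 : ((1 : ℝ) / 2) ^ (j + 1) = 1 / 2 ^ (j + 1) := by rw [one_div_pow]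
    rw [e2]
    conv_lhs =>
      enter [2, 2, 2]
      rw [e1]
    field_simp
    ring
  have hsup : ∀ J σ, (⨆ θ, (1 / (N : ℝ)) * ∑ i, bsgn (σ i) * V θ i) ≤
      (1 / 2) ^ J + ∑ j ∈ Finset.range J, M j σ := by
    intro J σ
    refine ciSup_le fun θ => ?_
    have e0 : ∀ i, V θ i = (V θ i - p J θ i) +
        ∑ j ∈ Finset.range J, (p (j+1) θ i - p j θ i) := by
      intro i
      rw [Finset.sum_range_sub (fun j => p j θ i), hp0]
      simp
    have e1 : (1 / (N : ℝ)) * ∑ i, bsgn (σ i) * V θ i =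
        (1 / (N : ℝ)) * ∑ i, bsgn (σ i) * (V θ i - p J θ i) +
        ∑ j ∈ Finset.range J, (1 / (N : ℝ)) * ∑ i, bsgn (σ i) * (p (j+1) θ - p j θ) i := by
      rw [← Finset.mul_sum, Finset.sum_comm, ← mul_add, ← Finset.sum_add_distrib]
      congr 1
      refine Finset.sum_congr rfl fun i _ => ?_
      rw [← Finset.mul_sum, ← mul_add]
      congr 1
      exact e0 i
    rw [e1]
    refine add_le_add ?_ (Finset.sum_le_sum fun j _ => ?_)
    · set ε : ℝ := (1 / 2) ^ J with hε
      have hε0 : 0 < ε := by positivity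
      have h1 : ∀ i ∈ Finset.univ, bsgn (σ i) * (V θ i - p J θ i) ≤
          ((V θ i - p J θ i) ^ 2 / ε + ε) / 2 := by
        intro i _
        have h2 : bsgn (σ i) * (V θ i - p J θ i) ≤ |V θ i - p J θ i| := by
          refine (le_abs_self _).trans (le_of_eq ?_)
          rw [abs_mul, bsgn_abs, one_mul]
        refine h2.trans ?_
        rw [← sq_abs (V θ i - p J θ i)]
        set a := |V θ i - p J θ i|
        have : (a ^ 2 / ε + ε) / 2 - a = (a - ε) ^ 2 / (2 * ε) := by field_simp; ring
        have : 0 ≤ (a - ε) ^ 2 / (2 * ε) := by positivity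
        linarith
      have h3 := Finset.sum_le_sum h1
      rw [← Finset.sum_div, Finset.sum_add_distrib, ← Finset.sum_div] at h3
      simp only [Finset.sum_const, Finset.card_univ, Fintype.card_fin, nsmul_eq_mul] at h3
      have h4 : (∑ i, (V θ i - p J θ i) ^ 2) / ε ≤ N * ε := by
        rw [div_le_iff₀ hε0]
        have := hp J θ
        nlinarith
      rw [one_div, inv_mul_le_iff₀ hN0]
      linarith
    · exact Finset.le_sup' (fun w : Fin N → ℝ => (1 / (N : ℝ)) * ∑ i, bsgn (σ i) * w i) (hmem j θ)
  have hJ : ∀ J : ℕ, ∑ σ : Fin N → Bool, (⨆ θ, (1 / (N : ℝ)) * ∑ i, bsgn (σ i) * V θ i) ≤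
      2 ^ N * (1 / 2) ^ J + 2 ^ N * (6 * Real.sqrt d * s / Real.sqrt N) := by
    intro J
    calc _ ≤ ∑ σ : Fin N → Bool, ((1 / 2 : ℝ) ^ J + ∑ j ∈ Finset.range J, M j σ) :=
          Finset.sum_le_sum fun σ _ => hsup J σ
      _ = 2 ^ N * (1 / 2) ^ J + ∑ j ∈ Finset.range J, ∑ σ, M j σ := by
          rw [Finset.sum_add_distrib, Finset.sum_comm]; simp
      _ ≤ 2 ^ N * (1 / 2) ^ J + ∑ j ∈ Finset.range J, 2 ^ N *
          ((2 * C / κ + 9 / 2 * κ) * (1 / 2) ^ (j + 1)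
          + 2 * d * Real.log 2 / κ * ((j + 1) * (1 / 2) ^ (j + 1))) / Real.sqrt N := by
          gcongr with j _
          exact hMj j
      _ = 2 ^ N * (1 / 2) ^ J + 2 ^ N *
          ((2 * C / κ + 9 / 2 * κ) * ∑ j ∈ Finset.range J, (1 / 2 : ℝ) ^ (j + 1)
          + 2 * d * Real.log 2 / κ * ∑ j ∈ Finset.range J, ((j : ℝ) + 1) * (1 / 2 : ℝ) ^ (j + 1))
            / Real.sqrt N := by
          rw [← Finset.sum_div, ← Finset.mul_sum, Finset.sum_add_distrib, ← Finset.mul_sum,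
            ← Finset.mul_sum]
      _ ≤ 2 ^ N * (1 / 2) ^ J + 2 ^ N *
          ((2 * C / κ + 9 / 2 * κ) * 1 + 2 * d * Real.log 2 / κ * 2) / Real.sqrt N := by
          have := (geo_sums J).1
          have := (geo_sums J).2
          gcongr
      _ ≤ _ := by
          rw [mul_div_assoc]
          have key : (2 * C / κ + 9 / 2 * κ) * 1 + 2 * d * Real.log 2 / κ * 2
              ≤ 6 * Real.sqrt d * s := by
            have e1 : (2 * C / κ + 9 / 2 * κ) * 1 + 2 * d * Real.log 2 / κ * 2
              = 3 * Real.sqrt d * ((C / d + 2 * Real.log 2) / s + s) := by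
              have e2 : (d : ℝ) = Real.sqrt d * Real.sqrt d := (Real.mul_self_sqrt hd0.le).symm
              have e3 : C = (C / d) * (Real.sqrt d * Real.sqrt d) := by
                rw [← e2]; field_simp
              set a := C / d
              rw [hκ]
              conv_lhs => rw [e3]
              conv_lhs =>
                enter [2, 1, 1, 1, 2]
                rw [e2]
              field_simp
              ring
            rw [e1]
            have : (C / d + 2 * Real.log 2) / s ≤ s := by
              rw [div_le_iff₀ hs0]; nlinarith
            nlinarith
          gcongr
  have hlim : Filter.Tendsto (fun J : ℕ => (2 : ℝ) ^ N * (1 / 2) ^ J +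
      2 ^ N * (6 * Real.sqrt d * s / Real.sqrt N)) Filter.atTop
      (nhds (2 ^ N * 0 + 2 ^ N * (6 * Real.sqrt d * s / Real.sqrt N))) :=
    ((tendsto_pow_atTop_nhds_zero_of_lt_one (by norm_num) (by norm_num)).const_mul _).add_const _
  refine (ge_of_tendsto' hlim hJ).trans (le_of_eq ?_)
  rw [Real.sqrt_mul Real.pi_pos.le, hs]
  ring

lemma abs_iSup_sub_le {ι : Type*} [Nonempty ι] (a b : ι → ℝ) (c M : ℝ) (ha : ∀ i, |a i| ≤ M)
    (hb : ∀ i, |b i| ≤ M) (h : ∀ i, |a i - b i| ≤ c) : |(⨆ i, a i) - ⨆ i, b i| ≤ c := by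
  have hA : BddAbove (Set.range a) := ⟨M, by rintro _ ⟨i, rfl⟩; exact (abs_le.1 (ha i)).2⟩
  have hB : BddAbove (Set.range b) := ⟨M, by rintro _ ⟨i, rfl⟩; exact (abs_le.1 (hb i)).2⟩
  rw [abs_le]
  constructor
  · have : (⨆ i, b i) ≤ (⨆ i, a i) + c := ciSup_le fun i => by
      have := le_ciSup hA i
      have := (abs_le.1 (h i)).1
      linarith
    linarith
  · have : (⨆ i, a i) ≤ (⨆ i, b i) + c := ciSup_le fun i => by
      have := le_ciSup hB i
      have := (abs_le.1 (h i)).2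
      linarith
    linarith

lemma abs_iSup_le {ι : Type*} [Nonempty ι] (a : ι → ℝ) (M : ℝ) (ha : ∀ i, |a i| ≤ M) :
    |⨆ i, a i| ≤ M := by
  have h0 : 0 ≤ M := (abs_nonneg _).trans (ha (Classical.arbitrary ι))
  have := abs_iSup_sub_le a (fun _ => 0) M M ha (fun _ => by simpa using h0)
    (fun i => by simpa using ha i)
  simpa using this

lemma abs_avg_le {N : ℕ} (hN : 1 ≤ N) (a : Fin N → ℝ) (ha : ∀ i, |a i| ≤ 1) :
    |(1 / (N : ℝ)) * ∑ i, a i| ≤ 1 := by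
  have hN0 : (0 : ℝ) < N := by exact_mod_cast hN
  rw [abs_mul, abs_of_pos (by positivity : (0 : ℝ) < 1 / N), one_div, inv_mul_le_iff₀ hN0]
  refine (Finset.abs_sum_le_sum_abs _ _).trans ((Finset.sum_le_sum fun i _ => ha i).trans ?_)
  simp

section symm
variable {E Z : Type*} [TopologicalSpace E] [PolishSpace E]
    [MeasurableSpace E] [BorelSpace E] [Nonempty E] [MeasurableSpace Z]

lemma symmetrization (P : Measure Z) [IsProbabilityMeasure P] {N : ℕ} (hN : 1 ≤ N)
    (h : E → Z → ℝ) (hm : Measurable fun q : E × Z => h q.1 q.2)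
    (h01 : ∀ θ z, h θ z ∈ Set.Icc (0 : ℝ) 1)
    (B : ℝ) (hB : ∀ D : Fin N → Z, ∑ σ : Fin N → Bool,
      (⨆ θ, (1 / (N : ℝ)) * ∑ i, bsgn (σ i) * h θ (D i)) ≤ 2 ^ N * B)
    (hΦ : Integrable (fun D : Fin N → Z => ⨆ θ, ((∫ z, h θ z ∂P) - (1 / (N : ℝ)) * ∑ i, h θ (D i)))
      (Measure.pi fun _ => P)) :
    ∫ D : Fin N → Z, (⨆ θ, ((∫ z, h θ z ∂P) - (1 / (N : ℝ)) * ∑ i, h θ (D i)))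
      ∂(Measure.pi fun _ => P) ≤ 2 * B := by
  have hN0 : (0 : ℝ) < N := by exact_mod_cast hN
  have habs : ∀ θ z, |h θ z| ≤ 1 := fun θ z => abs_le.2 ⟨by linarith [(h01 θ z).1], (h01 θ z).2⟩
  have hdiff : ∀ θ z z', |h θ z - h θ z'| ≤ 1 := fun θ z z' =>
    abs_le.2 ⟨by linarith [(h01 θ z).1, (h01 θ z').2], by linarith [(h01 θ z).2, (h01 θ z').1]⟩
  have hsd : ∀ (b : Bool) θ z z', |bsgn b * (h θ z - h θ z')| ≤ 1 := fun b θ z z' => by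
    rw [abs_mul, bsgn_abs, one_mul]; exact hdiff θ z z'
  have hsh : ∀ (b : Bool) θ z, |bsgn b * h θ z| ≤ 1 := fun b θ z => by
    rw [abs_mul, bsgn_abs, one_mul]; exact habs θ z
  let Ψ : (Fin N → Bool) → (Fin N → Z × Z) → ℝ := fun σ W =>
    ⨆ θ, (1 / (N : ℝ)) * ∑ i, bsgn (σ i) * (h θ (W i).2 - h θ (W i).1)
  have hΨb : ∀ σ W, |Ψ σ W| ≤ 1 := fun σ W =>
    abs_iSup_le _ _ fun θ => abs_avg_le hN _ fun i => hsd _ _ _ _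
  have hΨu : ∀ σ, UMeas (Ψ σ) := by
    intro σ
    refine umeas_iSup (fun p : E × (Fin N → Z × Z) =>
      (1 / (N : ℝ)) * ∑ i, bsgn (σ i) * (h p.1 (p.2 i).2 - h p.1 (p.2 i).1)) ?_ 1 ?_
    · refine Measurable.const_mul (Finset.measurable_sum _ fun i _ => ?_) _
      refine Measurable.const_mul (Measurable.sub ?_ ?_) _
      · exact hm.comp (measurable_fst.prodMk (by fun_prop))
      · exact hm.comp (measurable_fst.prodMk (by fun_prop))
    · exact fun p => abs_avg_le hN _ fun i => hsd _ _ _ _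
  let τ : Fin N → Bool := fun _ => true
  -- the two-sample process
  let Ψ' : (Fin N → Z) × (Fin N → Z) → ℝ := fun q =>
    ⨆ θ, (1 / (N : ℝ)) * ∑ i, (h θ (q.2 i) - h θ (q.1 i))
  have hΨ'b : ∀ q, |Ψ' q| ≤ 1 := fun q =>
    abs_iSup_le _ _ fun θ => abs_avg_le hN _ fun i => hdiff _ _ _
  have hΨ'u : UMeas Ψ' := by
    refine umeas_iSup (fun p : E × ((Fin N → Z) × (Fin N → Z)) =>
      (1 / (N : ℝ)) * ∑ i, (h p.1 (p.2.2 i) - h p.1 (p.2.1 i))) ?_ 1 ?_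
    · refine Measurable.const_mul (Finset.measurable_sum _ fun i _ => ?_) _
      refine Measurable.sub ?_ ?_
      · exact hm.comp (measurable_fst.prodMk (by fun_prop))
      · exact hm.comp (measurable_fst.prodMk (by fun_prop))
    · exact fun p => abs_avg_le hN _ fun i => hdiff _ _ _
  have stepA : ∫ D : Fin N → Z, (⨆ θ, ((∫ z, h θ z ∂P) - (1 / (N : ℝ)) * ∑ i, h θ (D i)))
      ∂(Measure.pi fun _ => P) ≤
      ∫ q, Ψ' q ∂((Measure.pi fun _ : Fin N => P).prod (Measure.pi fun _ : Fin N => P)) := by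
    have hI := hΨ'u.integrable hΨ'b
      ((Measure.pi fun _ : Fin N => P).prod (Measure.pi fun _ : Fin N => P))
    rw [integral_prod _ hI]
    refine integral_mono hΦ hI.integral_prod_left fun D => ?_
    refine ciSup_le fun θ => ?_
    have hmθ : Measurable (h θ) := hm.comp (measurable_const.prodMk measurable_id)
    have hIθ : ∀ i : Fin N, Integrable (fun D' : Fin N → Z => h θ (D' i))
        (Measure.pi fun _ => P) := fun i =>
      Integrable.of_bound (hmθ.comp (measurable_pi_apply i)).aestronglyMeasurable 1
        (Filter.Eventually.of_forall fun D' => by simpa using habs θ (D' i))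
    have hEi : ∀ i : Fin N, ∫ D' : Fin N → Z, h θ (D' i) ∂(Measure.pi fun _ => P)
        = ∫ z, h θ z ∂P := by
      intro i
      have hmp := measurePreserving_eval (fun _ : Fin N => P) i
      have := integral_map (μ := Measure.pi fun _ : Fin N => P) hmp.measurable.aemeasurable
        (f := h θ) hmθ.aestronglyMeasurable
      rw [hmp.map_eq] at this
      exact this.symm
    have hId : ∀ i : Fin N, Integrable (fun D' : Fin N → Z => h θ (D' i) - h θ (D i))
        (Measure.pi fun _ => P) := fun i => (hIθ i).sub (integrable_const _)
    have e1 : (∫ z, h θ z ∂P) - (1 / (N : ℝ)) * ∑ i, h θ (D i) =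
        ∫ D' : Fin N → Z, (1 / (N : ℝ)) * ∑ i, (h θ (D' i) - h θ (D i))
          ∂(Measure.pi fun _ => P) := by
      rw [integral_const_mul, integral_finsetSum _ fun i _ => hId i]
      simp_rw [fun i => integral_sub (hIθ i) (integrable_const (h θ (D i))), hEi]
      simp only [integral_const, probReal_univ, smul_eq_mul, one_mul, Finset.sum_sub_distrib,
        Finset.sum_const, Finset.card_univ, Fintype.card_fin, nsmul_eq_mul]
      field_simp
    rw [e1]
    have hsl : UMeas fun D' => Ψ' (D, D') := hΨ'u.comp (by fun_prop)
    refine integral_mono ?_ (hsl.integrable (fun D' => hΨ'b _) _) fun D' => ?_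
    · exact (integrable_finsetSum _ fun i _ => hId i).const_mul _
    · refine le_ciSup (f := fun θ => (1 / (N : ℝ)) * ∑ i, (h θ (D' i) - h θ (D i))) ?_ θ
      refine ⟨1, ?_⟩
      rintro _ ⟨θ, rfl⟩
      exact (abs_le.1 (abs_avg_le hN _ fun i => hdiff _ _ _)).2
  have stepA' : ∫ q, Ψ' q ∂((Measure.pi fun _ : Fin N => P).prod (Measure.pi fun _ : Fin N => P))
      = ∫ W, Ψ τ W ∂(Measure.pi fun _ : Fin N => P.prod P) := by
    have := measurePreserving_arrowProdEquivProdArrow Z Z (Fin N) (fun _ => P) (fun _ => P)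
    rw [← this.integral_comp']
    refine integral_congr_ae (Filter.Eventually.of_forall fun W => ?_)
    simp only [Ψ', Ψ, τ, bsgn, if_true, one_mul]
    rfl
  have stepB : ∀ σ, ∫ W, Ψ σ W ∂(Measure.pi fun _ : Fin N => P.prod P)
      = ∫ W, Ψ τ W ∂(Measure.pi fun _ : Fin N => P.prod P) := by
    intro σ
    let fl : Fin N → Z × Z → Z × Z := fun i => if σ i then id else Prod.swap
    have hfl : ∀ i, MeasurePreserving (fl i) (P.prod P) (P.prod P) := by
      intro i
      by_cases hσ : σ i = true
      · simp only [fl, hσ, if_true]; exact MeasurePreserving.id _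
      · simp only [fl, hσ]; exact Measure.measurePreserving_swap
    have hmp := measurePreserving_pi (fun _ : Fin N => P.prod P) (fun _ : Fin N => P.prod P) hfl
    have := integral_map (μ := Measure.pi fun _ : Fin N => P.prod P) hmp.measurable.aemeasurable
        (f := Ψ τ) (hΨu τ _ inferInstance).aestronglyMeasurable
    rw [hmp.map_eq] at this
    rw [this]
    refine integral_congr_ae (Filter.Eventually.of_forall fun W => ?_)
    simp only [Ψ]
    refine iSup_congr fun θ => ?_
    congr 1
    refine Finset.sum_congr rfl fun i _ => ?_
    by_cases hσ : σ i = true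
    · simp [fl, hσ, τ]
    · simp [fl, hσ, τ, bsgn]
  have stepC : ∀ W, ∑ σ, Ψ σ W ≤ 2 ^ N * (2 * B) := by
    intro W
    have h1 : ∀ σ, Ψ σ W ≤ (⨆ θ, (1 / (N : ℝ)) * ∑ i, bsgn (σ i) * h θ (W i).2) +
        ⨆ θ, (1 / (N : ℝ)) * ∑ i, bsgn (!σ i) * h θ (W i).1 := by
      intro σ
      refine ciSup_le fun θ => ?_
      have e : (1 / (N : ℝ)) * ∑ i, bsgn (σ i) * (h θ (W i).2 - h θ (W i).1) =
          (1 / (N : ℝ)) * ∑ i, bsgn (σ i) * h θ (W i).2 +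
          (1 / (N : ℝ)) * ∑ i, bsgn (!σ i) * h θ (W i).1 := by
        rw [← mul_add, ← Finset.sum_add_distrib]
        congr 1
        refine Finset.sum_congr rfl fun i _ => ?_
        cases σ i <;> simp [bsgn] <;> ring
      rw [e]
      refine add_le_add ?_ ?_
      · refine le_ciSup (f := fun θ => (1 / (N : ℝ)) * ∑ i, bsgn (σ i) * h θ (W i).2) ⟨1, ?_⟩ θ
        rintro _ ⟨θ, rfl⟩
        exact (abs_le.1 (abs_avg_le hN _ fun i => hsh _ _ _)).2
      · refine le_ciSup (f := fun θ => (1 / (N : ℝ)) * ∑ i, bsgn (!σ i) * h θ (W i).1) ⟨1, ?_⟩ θ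
        rintro _ ⟨θ, rfl⟩
        exact (abs_le.1 (abs_avg_le hN _ fun i => hsh _ _ _)).2
    refine (Finset.sum_le_sum fun σ _ => h1 σ).trans ?_
    rw [Finset.sum_add_distrib]
    have h2 := hB fun i => (W i).2
    have h3 := hB fun i => (W i).1
    have hinv : Function.Involutive fun σ : Fin N → Bool => fun i => !σ i := fun σ => by
      funext i; simp
    have h4 := Equiv.sum_comp hinv.toPerm fun σ : Fin N → Bool =>
      ⨆ θ, (1 / (N : ℝ)) * ∑ i, bsgn (σ i) * h θ (W i).1
    simp only [Function.Involutive.coe_toPerm] at h4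
    rw [h4]
    linarith
  have hfin : (2 : ℝ) ^ N * ∫ W, Ψ τ W ∂(Measure.pi fun _ : Fin N => P.prod P)
      ≤ 2 ^ N * (2 * B) := by
    have e1 : (2 : ℝ) ^ N * ∫ W, Ψ τ W ∂(Measure.pi fun _ : Fin N => P.prod P) =
        ∑ σ, ∫ W, Ψ σ W ∂(Measure.pi fun _ : Fin N => P.prod P) := by
      simp_rw [stepB]
      simp
    have hIσ : ∀ σ, Integrable (Ψ σ) (Measure.pi fun _ : Fin N => P.prod P) := fun σ =>
      (hΨu σ).integrable (hΨb σ) _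
    rw [e1, ← integral_finsetSum _ fun σ _ => hIσ σ]
    refine (integral_mono (integrable_finsetSum _ fun σ _ => hIσ σ)
      (integrable_const (2 ^ N * (2 * B))) stepC).trans ?_
    simp
  have := le_of_mul_le_mul_left hfin (by positivity)
  linarith [stepA, stepA']

lemma uniform_bound (P : Measure Z) [IsProbabilityMeasure P] {N : ℕ} (hN : 1 ≤ N)
    (h : E → Z → ℝ) (hm : Measurable fun q : E × Z => h q.1 q.2)
    (h01 : ∀ θ z, h θ z ∈ Set.Icc (0 : ℝ) 1)
    (B : ℝ) (hB : ∀ D : Fin N → Z, ∑ σ : Fin N → Bool,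
      (⨆ θ, (1 / (N : ℝ)) * ∑ i, bsgn (σ i) * h θ (D i)) ≤ 2 ^ N * B)
    (s : ℝ) (hs : 0 ≤ s) :
    (Measure.pi fun _ : Fin N => P).real {D | ∃ θ, (1 / (N : ℝ)) * ∑ i, h θ (D i) + 2 * B + s <
      ∫ z, h θ z ∂P} ≤ Real.exp (-2 * N * s ^ 2) := by
  have hN0 : (0 : ℝ) < N := by exact_mod_cast hN
  have habs : ∀ θ z, |h θ z| ≤ 1 := fun θ z => abs_le.2 ⟨by linarith [(h01 θ z).1], (h01 θ z).2⟩
  have hdiff : ∀ θ z z', |h θ z - h θ z'| ≤ 1 := fun θ z z' =>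
    abs_le.2 ⟨by linarith [(h01 θ z).1, (h01 θ z').2], by linarith [(h01 θ z).2, (h01 θ z').1]⟩
  let F : E × (Fin N → Z) → ℝ := fun p => (∫ z, h p.1 z ∂P) - (1 / (N : ℝ)) * ∑ i, h p.1 (p.2 i)
  have hR : ∀ θ, |∫ z, h θ z ∂P| ≤ 1 := by
    intro θ
    have := norm_integral_le_of_norm_le_const (μ := P) (f := h θ) (C := 1)
        (Filter.Eventually.of_forall fun z => by simpa using habs θ z)
    simpa using this
  have hFb : ∀ p, |F p| ≤ 2 := fun p => by
    refine (abs_sub _ _).trans ?_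
    have := hR p.1
    have := abs_avg_le hN (fun i => h p.1 (p.2 i)) fun i => habs _ _
    linarith
  have hFm : Measurable F := by
    refine Measurable.sub ?_ ?_
    · have : StronglyMeasurable fun θ => ∫ z, h θ z ∂P :=
        (hm.stronglyMeasurable).integral_prod_right'
      exact this.measurable.comp measurable_fst
    · refine Measurable.const_mul (Finset.measurable_sum _ fun i _ => ?_) _
      exact hm.comp (measurable_fst.prodMk (by fun_prop))
  let Φ : (Fin N → Z) → ℝ := fun D => ⨆ θ, F (θ, D)
  have hΦu : UMeas Φ := umeas_iSup F hFm 2 hFb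
  have hΦb : ∀ D, |Φ D| ≤ 2 := fun D => abs_iSup_le _ _ fun θ => hFb _
  have hΦc : ∀ x i z, |Φ (Function.update x i z) - Φ x| ≤ 1 / (N : ℝ) := by
    intro x i z
    refine abs_iSup_sub_le _ _ _ 2 (fun θ => hFb _) (fun θ => hFb _) fun θ => ?_
    have e : F (θ, Function.update x i z) - F (θ, x) = (1 / (N : ℝ)) * (h θ (x i) - h θ z) := by
      simp only [F]
      rw [sub_sub_sub_cancel_left, ← mul_sub, ← Finset.sum_sub_distrib]
      congr 1
      rw [Finset.sum_eq_single i]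
      · simp
      · intro j _ hj
        simp [Function.update_of_ne hj]
      · simp
    rw [e, abs_mul, abs_of_pos (by positivity : (0 : ℝ) < 1 / N)]
    exact mul_le_of_le_one_right (by positivity) (hdiff _ _ _)
  have hE := symmetrization P hN h hm h01 B hB (hΦu.integrable hΦb _)
  refine le_trans (measureReal_mono ?_) (mcdiarmid_tail P hN Φ hΦu 2 hΦb hΦc s hs)
  rintro D ⟨θ, hθ⟩
  have h1 : F (θ, D) ≤ Φ D := le_ciSup (f := fun θ => F (θ, D))
    ⟨2, by rintro _ ⟨θ, rfl⟩; exact (abs_le.1 (hFb _)).2⟩ θ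
  have h2 : ∫ w, Φ w ∂(Measure.pi fun _ => P) ≤ 2 * B := hE
  simp only [F] at h1
  change s ≤ Φ D - _
  linarith
end symm

/-- **Effective dimension and QFIM generalization bound** (Corollary 2). -/
theorem effective_dimension_generalization_bound
    {d N : ℕ} (hd : 1 ≤ d) (hN : 1 ≤ N)
    {δ : ℝ} (hδ : δ ∈ Set.Ioo (0 : ℝ) 1)
    {X Y : Type*} [MeasurableSpace X] [MeasurableSpace Y]
    (P : Measure (X × Y)) [IsProbabilityMeasure P]
    (Θ : Set (EuclideanSpace ℝ (Fin d))) (hΘne : Θ.Nonempty) (hΘcpt : IsCompact Θ)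
    (𝔉 : EuclideanSpace ℝ (Fin d) → Matrix (Fin d) (Fin d) ℝ)
    (h𝔉symm : ∀ θ ∈ Θ, (𝔉 θ).IsSymm)
    (h𝔉pd : ∀ θ ∈ Θ, (𝔉 θ).PosDef)
    (lam : EuclideanSpace ℝ (Fin d) → Fin d → ℝ)
    (hlamEig : ∀ θ ∈ Θ, ∀ i : Fin d, ∃ v : Fin d → ℝ, v ≠ 0 ∧ (𝔉 θ).mulVec v = lam θ i • v)
    (hlamSorted : ∀ θ ∈ Θ, ∀ i j : Fin d, i ≤ j → lam θ j ≤ lam θ i)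
    (hlamPos : ∀ θ ∈ Θ, ∀ i : Fin d, 0 < lam θ i)
    (α : ℝ) (hα : 0 < α)
    (deff : ℕ)
    (hdeff : IsGreatest
      {r : ℕ | 1 ≤ r ∧ r ≤ d ∧ ∀ θ ∈ Θ, ∀ i : Fin d, (i : ℕ) + 1 = r → α ≤ lam θ i} deff)
    (Θloc : Set (EuclideanSpace ℝ (Fin d)))
    (hΘlocsub : Θloc ⊆ Θ) (hΘlocne : Θloc.Nonempty) (hΘloccpt : IsCompact Θloc)
    (f : EuclideanSpace ℝ (Fin d) → X → ℝ)
    (hfmeas : Measurable (fun q : EuclideanSpace ℝ (Fin d) × X => f q.1 q.2))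
    (hf01 : ∀ θ x, f θ x ∈ Set.Icc (0 : ℝ) 1)
    (ℓ : Y → ℝ → ℝ)
    (hℓmeas : Measurable (fun q : Y × ℝ => ℓ q.1 q.2))
    (hℓ01 : ∀ y t, ℓ y t ∈ Set.Icc (0 : ℝ) 1)
    (L : ℝ) (hL1 : L ≤ 1)
    (hℓLip : ∀ y t t', |ℓ y t - ℓ y t'| ≤ L * |t - t'|)
    (Cloc : ℝ) (hCloc0 : 0 ≤ Cloc)
    (hcov : ∀ xs : Fin N → X, ∀ ε ∈ Set.Ioc (0 : ℝ) 1,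
      covN (empDist xs) ε {g : X → ℝ | ∃ θ ∈ Θloc, g = f θ} ≠ ⊤ ∧
      Real.log ((covN (empDist xs) ε {g : X → ℝ | ∃ θ ∈ Θloc, g = f θ}).toNat : ℝ)
        ≤ Cloc - deff * Real.log ε) :
    ENNReal.ofReal (1 - δ) ≤
      Measure.pi (fun _ : Fin N => P)
        {D : Fin N → X × Y | ∀ θ ∈ Θloc,
          (∫ z, ℓ z.2 (f θ z.1) ∂P) ≤
            (1 / (N : ℝ)) * ∑ i, ℓ (D i).2 (f θ (D i).1)
              + 12 * Real.sqrt (Real.pi * (deff : ℝ)) * Real.exp (Cloc / (deff : ℝ))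
                  / Real.sqrt (N : ℝ)
              + 3 * Real.sqrt (Real.log (2 / δ) / (2 * (N : ℝ))) } := by
  classical
  have hd1 : 1 ≤ deff := hdeff.1.1
  have hN0 : (0 : ℝ) < N := by exact_mod_cast hN
  have : Nonempty Θloc := hΘlocne.to_subtype
  have : PolishSpace Θloc := hΘloccpt.isClosed.polishSpace
  let h : Θloc → X × Y → ℝ := fun θ z => ℓ z.2 (f θ z.1)
  have hm : Measurable fun q : Θloc × (X × Y) => h q.1 q.2 := by
    have h1 : Measurable fun q : Θloc × (X × Y) => f q.1 q.2.1 :=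
      hfmeas.comp ((measurable_subtype_coe.comp measurable_fst).prodMk (by fun_prop))
    exact hℓmeas.comp ((by fun_prop : Measurable fun q : Θloc × (X × Y) => q.2.2).prodMk h1)
  have h01 : ∀ θ z, h θ z ∈ Set.Icc (0 : ℝ) 1 := fun θ z => hℓ01 _ _
  set B : ℝ := 6 * Real.sqrt (Real.pi * deff) * Real.exp (Cloc / deff) / Real.sqrt N with hBdef
  have hB : ∀ D : Fin N → X × Y, ∑ σ : Fin N → Bool,
      (⨆ θ, (1 / (N : ℝ)) * ∑ i, bsgn (σ i) * h θ (D i)) ≤ 2 ^ N * B := by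
    intro D
    refine dudley hN (fun θ i => h θ (D i)) (fun θ i => ?_) Cloc hCloc0 deff hd1 fun j => ?_
    · exact abs_le.2 ⟨by linarith [(h01 θ (D i)).1], (h01 θ (D i)).2⟩
    set ε : ℝ := (1 / 2) ^ j with hε
    have hε0 : 0 < ε := by positivity
    have hε1 : ε ≤ 1 := pow_le_one₀ (by norm_num) (by norm_num)
    obtain ⟨hfin, hlog⟩ := hcov (fun i => (D i).1) ε ⟨hε0, hε1⟩
    have hne : {k : ℕ∞ | ∃ T : Finset (X → ℝ), (T.card : ℕ∞) = k ∧
        ∀ s ∈ {g : X → ℝ | ∃ θ ∈ Θloc, g = f θ}, ∃ c ∈ T,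
          empDist (fun i => (D i).1) s c ≤ ε}.Nonempty := by
      by_contra hcon
      rw [Set.not_nonempty_iff_eq_empty] at hcon
      apply hfin
      rw [covN, hcon]
      exact sInf_empty
    obtain ⟨T, hTc, hT⟩ := csInf_mem hne
    change (T.card : ℕ∞) = covN (empDist fun i => (D i).1) ε _ at hTc
    rw [← hTc] at hlog
    simp only [ENat.toNat_coe] at hlog
    refine ⟨T.image fun c i => ℓ (D i).2 (c (D i).1), ?_, fun θ => ?_⟩
    · have h1 : ((T.image fun c i => ℓ (D i).2 (c (D i).1)).card : ℝ) ≤ T.card := by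
        exact_mod_cast Finset.card_image_le
      refine h1.trans ?_
      rcases Nat.eq_zero_or_pos T.card with h0 | h0
      · rw [h0]; simpa using (Real.exp_pos _).le
      · rw [← Real.log_le_iff_le_exp (by exact_mod_cast h0)]
        refine hlog.trans (le_of_eq ?_)
        rw [hε, Real.log_pow, one_div, Real.log_inv]
        ring
    · obtain ⟨c, hc, hcd⟩ := hT (f θ) ⟨θ, θ.2, rfl⟩
      refine ⟨_, Finset.mem_image.2 ⟨c, hc, rfl⟩, ?_⟩
      rw [empDist, Real.sqrt_le_left hε0.le, one_div, inv_mul_le_iff₀ hN0] at hcd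
      rw [mul_comm]
      refine le_trans (Finset.sum_le_sum fun i _ => ?_) hcd
      rw [sq_le_sq]
      refine (hℓLip _ _ _).trans ?_
      exact mul_le_of_le_one_left (abs_nonneg _) hL1
  set s : ℝ := Real.sqrt (Real.log (2 / δ) / (2 * (N : ℝ))) with hs
  have hs0 : 0 ≤ s := Real.sqrt_nonneg _
  have hub := uniform_bound P hN h hm h01 B hB s hs0
  have hδ2 : 0 < 2 / δ := div_pos two_pos hδ.1
  have hlogδ : 0 ≤ Real.log (2 / δ) := Real.log_nonneg (by
    rw [le_div_iff₀ hδ.1]; linarith [hδ.2])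
  have hexp : Real.exp (-2 * N * s ^ 2) ≤ δ := by
    rw [hs, Real.sq_sqrt (by positivity)]
    have e : -2 * (N : ℝ) * (Real.log (2 / δ) / (2 * N)) = - Real.log (2 / δ) := by field_simp
    rw [e, Real.exp_neg, Real.exp_log hδ2, inv_div]
    linarith [hδ.1]
  set S : Set (Fin N → X × Y) := {D | ∀ θ ∈ Θloc,
          (∫ z, ℓ z.2 (f θ z.1) ∂P) ≤
            (1 / (N : ℝ)) * ∑ i, ℓ (D i).2 (f θ (D i).1)
              + 12 * Real.sqrt (Real.pi * (deff : ℝ)) * Real.exp (Cloc / (deff : ℝ))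
                  / Real.sqrt (N : ℝ)
              + 3 * s } with hS
  have hSc : (Measure.pi fun _ : Fin N => P) Sᶜ ≤ ENNReal.ofReal δ := by
    have h2 : Sᶜ ⊆ {D | ∃ θ, (1 / (N : ℝ)) * ∑ i, h θ (D i) + 2 * B + s < ∫ z, h θ z ∂P} := by
      intro D hD
      simp only [hS, Set.mem_compl_iff, Set.mem_ofPred_eq, not_forall, not_le] at hD
      obtain ⟨θ, hθ, hlt⟩ := hD
      refine ⟨⟨θ, hθ⟩, lt_of_le_of_lt ?_ hlt⟩
      have e : 2 * B = 12 * Real.sqrt (Real.pi * (deff : ℝ)) * Real.exp (Cloc / (deff : ℝ))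
                  / Real.sqrt (N : ℝ) := by rw [hBdef]; ring
      rw [e]
      simp only [h]
      linarith
    refine (measure_mono h2).trans ?_
    rw [← ofReal_measureReal]
    exact ENNReal.ofReal_le_ofReal (hub.trans hexp)
  have hone : (1 : ENNReal) ≤ (Measure.pi fun _ : Fin N => P) S + ENNReal.ofReal δ := by
    calc (1 : ENNReal) = (Measure.pi fun _ : Fin N => P) (S ∪ Sᶜ) := by
          rw [Set.union_compl_self, measure_univ]
      _ ≤ _ := (measure_union_le _ _).trans (add_le_add le_rfl hSc)
  rw [ENNReal.ofReal_sub _ hδ.1.le, ENNReal.ofReal_one]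
  exact tsub_le_iff_right.2 hone
end

section
/- Let d, N ∈ ℕ with d, N ≥ 1, let Θ ⊆ ℝ^d be nonempty and compact, let X be a set and x_1,…,x_N ∈ X fixed sample points. Let f : Θ → X → ℝ be such that f_θ(x) ∈ [0,1] for all θ ∈ Θ and x ∈ X and θ ↦ f_θ(x_i) is continuous for each i. Suppose there exists C' ≥ 0 such that the covering numbers of the function class F_Θ = {x ↦ f_θ(x) : θ ∈ Θ} in the empirical L2 seminorm satisfy log N(ε, F_Θ, ‖·‖_{2,D}) ≤ C' − d·log ε for all ε ∈ (0,1] (in the paper, C' = log V_Θ − log V_d − log m + d·log L_f^p is obtained from the Fisher-information volume bound combined with the Lipschitz property of θ ↦ f_{θ,p}). Then the empirical Rademacher complexity of F_Θ on the sample x_1,…,x_N satisfies R̂_N(F_Θ) ≤ 6·√(π·d)·exp(C'/d)/√N. -/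
/-- signed sum -/
noncomputable def sgnSum {N : ℕ} (σ : Fin N → Bool) (v : EuclideanSpace ℝ (Fin N)) : ℝ :=
  ∑ i, (if σ i then (1 : ℝ) else -1) * v i

lemma sgnSum_sub {N : ℕ} (σ : Fin N → Bool) (u v : EuclideanSpace ℝ (Fin N)) :
    sgnSum σ (u - v) = sgnSum σ u - sgnSum σ v := by
  simp [sgnSum, mul_sub, Finset.sum_sub_distrib]

lemma sgnSum_le {N : ℕ} (σ : Fin N → Bool) (v : EuclideanSpace ℝ (Fin N)) :
    sgnSum σ v ≤ Real.sqrt N * ‖v‖ := by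
  have h := Finset.sum_mul_sq_le_sq_mul_sq Finset.univ
    (fun i => if σ i then (1 : ℝ) else -1) (fun i => v i)
  have h1 : ∑ i : Fin N, (if σ i then (1 : ℝ) else -1) ^ 2 = N := by
    rw [Finset.sum_congr rfl (g := fun _ => (1 : ℝ))]
    · simp
    · intro i _; split_ifs <;> norm_num
  rw [h1] at h
  rw [EuclideanSpace.norm_eq, ← Real.sqrt_mul (by positivity)]
  apply Real.le_sqrt_of_sq_le
  simpa [sgnSum] using h

lemma sum_exp_sgnSum {N : ℕ} (l : ℝ) (t : EuclideanSpace ℝ (Fin N)) :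
    ∑ σ : Fin N → Bool, Real.exp (l * sgnSum σ t) ≤ 2 ^ N * Real.exp (l ^ 2 * ‖t‖ ^ 2 / 2) := by
  have h1 : ∀ σ : Fin N → Bool, Real.exp (l * sgnSum σ t)
      = ∏ i, Real.exp ((if σ i then (1 : ℝ) else -1) * (l * t i)) := by
    intro σ
    rw [← Real.exp_sum, sgnSum, Finset.mul_sum]
    congr 1
    exact Finset.sum_congr rfl fun i _ => by ring
  simp_rw [h1]
  have h2 := Finset.prod_univ_sum (fun _ : Fin N => (Finset.univ : Finset Bool))
    (fun i b => Real.exp ((if b then (1 : ℝ) else -1) * (l * t i)))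
  rw [Fintype.piFinset_univ] at h2
  rw [← h2]
  calc _ ≤ ∏ i : Fin N, (2 * Real.exp ((l * t i) ^ 2 / 2)) := by
        apply Finset.prod_le_prod
        · intro i _; positivity
        · intro i _
          have := Real.cosh_le_exp_half_sq (l * t i)
          rw [Real.cosh_eq] at this
          simp
          linarith
    _ = _ := by
        rw [Finset.prod_mul_distrib, ← Real.exp_sum, EuclideanSpace.norm_sq_eq]
        simp [Finset.mul_sum, Finset.sum_div, mul_pow]

lemma massart_s4 {N : ℕ} (P : Finset (EuclideanSpace ℝ (Fin N))) (L l ρ : ℝ) (hl : 0 < l)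
    (hP : ∀ t ∈ P, ‖t‖ ≤ ρ) (hL : (P.card : ℝ) ≤ Real.exp L) :
    ∃ S : (Fin N → Bool) → ℝ, (∀ σ, ∀ t ∈ P, sgnSum σ t ≤ S σ) ∧
      ∑ σ, S σ ≤ 2 ^ N * (L / l + l * ρ ^ 2 / 2) := by
  set K := L + l ^ 2 * ρ ^ 2 / 2 with hK
  refine ⟨fun σ => ((∑ t ∈ P, Real.exp (l * sgnSum σ t)) * Real.exp (-K) - 1 + K) / l, ?_, ?_⟩
  · intro σ t ht
    rw [le_div_iff₀ hl]
    have h1 : Real.exp (l * sgnSum σ t) ≤ ∑ t ∈ P, Real.exp (l * sgnSum σ t) :=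
      Finset.single_le_sum (f := fun t => Real.exp (l * sgnSum σ t))
        (fun _ _ => (Real.exp_pos _).le) ht
    have h2 := Real.add_one_le_exp (l * sgnSum σ t + -K)
    rw [Real.exp_add] at h2
    have h3 := mul_le_mul_of_nonneg_right h1 (Real.exp_pos (-K)).le
    linarith
  · have h4 : ∑ σ : Fin N → Bool, ∑ t ∈ P, Real.exp (l * sgnSum σ t) ≤ 2 ^ N * Real.exp K := by
      rw [Finset.sum_comm]
      calc _ ≤ ∑ t ∈ P, (2 ^ N * Real.exp (l ^ 2 * ρ ^ 2 / 2)) := by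
            apply Finset.sum_le_sum
            intro t ht
            refine (sum_exp_sgnSum l t).trans ?_
            have := hP t ht
            gcongr
        _ = P.card * (2 ^ N * Real.exp (l ^ 2 * ρ ^ 2 / 2)) := by simp
        _ ≤ Real.exp L * (2 ^ N * Real.exp (l ^ 2 * ρ ^ 2 / 2)) := by gcongr
        _ = _ := by rw [hK, Real.exp_add]; ring
    rw [← Finset.sum_div, Finset.sum_add_distrib, Finset.sum_sub_distrib, ← Finset.sum_mul]
    have h5 := mul_le_mul_of_nonneg_right h4 (Real.exp_pos (-K)).le
    rw [mul_assoc, ← Real.exp_add, add_neg_cancel, Real.exp_zero] at h5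
    rw [div_le_iff₀ hl]
    simp
    have : (L / l + l * ρ ^ 2 / 2) * l = K := by rw [hK]; field_simp
    rw [mul_assoc, this]
    linarith

lemma chain {N d : ℕ} (hd : 1 ≤ d) (U : Set (EuclideanSpace ℝ (Fin N))) (C R : ℝ) (hC : 0 ≤ C)
    (hR : 0 < R) (T : ℕ → Finset (EuclideanSpace ℝ (Fin N))) (hT0 : T 0 = {0})
    (hcard : ∀ j, ((T j).card : ℝ) ≤ Real.exp (C + d * (j * Real.log 2)))
    (hT : ∀ j, ∀ u ∈ U, ∃ c ∈ T j, ‖u - c‖ ≤ R * (1 / 2) ^ j) (J : ℕ) :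
    ∃ B : (Fin N → Bool) → ℝ,
      (∀ σ, ∀ u ∈ U, ∀ c ∈ T J, ‖u - c‖ ≤ R * (1 / 2) ^ J → sgnSum σ c ≤ B σ) ∧
      ∑ σ, B σ ≤ 2 ^ N * (3 * R * Real.sqrt d * (Real.exp (C / d) * (1 - (1 / 2) ^ J)
        + 0.7 * (2 - (J + 2) * (1 / 2) ^ J))) := by
  classical
  induction J with
  | zero =>
    refine ⟨fun _ => 0, ?_, ?_⟩
    · intro σ u _ c hc _
      rw [hT0, Finset.mem_singleton] at hc
      simp [hc, sgnSum]
    · simp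
  | succ J ih =>
    obtain ⟨B, hB, hBs⟩ := ih
    have hd0 : (0 : ℝ) < d := by exact_mod_cast hd
    have hsd : 0 < Real.sqrt d := Real.sqrt_pos.2 hd0
    set ρ : ℝ := 3 * R * (1 / 2) ^ (J + 1) with hρ
    have hρ0 : 0 < ρ := by positivity
    set P : Finset (EuclideanSpace ℝ (Fin N)) :=
      (((T (J + 1)) ×ˢ (T J)).image (fun p => p.1 - p.2)).filter (fun t => ‖t‖ ≤ ρ) with hPdef
    set L : ℝ := 2 * (C + d * ((J + 1 : ℕ) * Real.log 2)) with hLdef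
    have hlog2 : 0 ≤ Real.log 2 := Real.log_nonneg (by norm_num)
    have hPc : (P.card : ℝ) ≤ Real.exp L := by
      have h1 : P.card ≤ (T (J + 1)).card * (T J).card := by
        rw [← Finset.card_product]
        exact (Finset.card_filter_le _ _).trans Finset.card_image_le
      have h2 : (P.card : ℝ) ≤ (T (J + 1)).card * (T J).card := by exact_mod_cast h1
      have h3 : ((T J).card : ℝ) ≤ Real.exp (C + d * ((J + 1 : ℕ) * Real.log 2)) := by
        refine (hcard J).trans (Real.exp_le_exp.2 ?_)
        push_cast
        gcongr
        linarith
      refine h2.trans ?_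
      rw [hLdef, two_mul, Real.exp_add]
      exact mul_le_mul (hcard (J + 1)) h3 (by positivity) (Real.exp_pos _).le
    obtain ⟨S, hS, hSs⟩ := massart_s4 P L (2 * Real.sqrt d / ρ) ρ (by positivity)
      (fun t ht => (Finset.mem_filter.1 ht).2) hPc
    refine ⟨fun σ => B σ + S σ, ?_, ?_⟩
    · intro σ u hu c hc huc
      obtain ⟨c', hc', huc'⟩ := hT J u hu
      have h1 := hB σ u hu c' hc' huc'
      have h2 : c - c' ∈ P := by
        rw [hPdef, Finset.mem_filter]
        refine ⟨Finset.mem_image.2 ⟨(c, c'), Finset.mem_product.2 ⟨hc, hc'⟩, rfl⟩, ?_⟩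
        have : c - c' = (u - c') - (u - c) := by abel
        rw [this]
        refine (norm_sub_le _ _).trans ?_
        rw [hρ]
        rw [pow_succ] at huc ⊢
        linarith
      have h3 := hS σ _ h2
      rw [sgnSum_sub] at h3
      linarith
    · rw [Finset.sum_add_distrib]
      have h4 : L / (2 * Real.sqrt d / ρ) + (2 * Real.sqrt d / ρ) * ρ ^ 2 / 2
          = ρ * Real.sqrt d * (C / d + (J + 1) * Real.log 2 + 1) := by
        have hs : Real.sqrt d ^ 2 = d := Real.sq_sqrt hd0.le
        have : (d : ℝ) ≠ 0 := hd0.ne'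
        rw [hLdef]
        push_cast
        generalize Real.sqrt d = s at *
        rw [← hs] at this ⊢
        field_simp
      have h5 : C / d + 1 ≤ Real.exp (C / d) := Real.add_one_le_exp _
      have h6 : Real.log 2 ≤ 0.7 := by linarith [Real.log_two_lt_d9]
      have h7 : C / d + (J + 1) * Real.log 2 + 1 ≤ Real.exp (C / d) + (J + 1) * 0.7 := by
        have : ((J : ℝ) + 1) * Real.log 2 ≤ (J + 1) * 0.7 := by gcongr
        linarith
      rw [h4] at hSs
      have h8 : ρ * Real.sqrt d * (C / d + (J + 1) * Real.log 2 + 1)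
          ≤ ρ * Real.sqrt d * (Real.exp (C / d) + (J + 1) * 0.7) := by gcongr
      have h9 := hSs.trans (mul_le_mul_of_nonneg_left h8 (by positivity))
      refine (add_le_add hBs h9).trans (le_of_eq ?_)
      rw [hρ]
      push_cast
      ring

lemma exists_cover {α : Type*} (ρ : α → α → ℝ) (ε : ℝ) (S : Set α) (h : covN ρ ε S ≠ ⊤) :
    ∃ T : Finset α, (T.card : ℕ∞) = covN ρ ε S ∧ ∀ s ∈ S, ∃ c ∈ T, ρ s c ≤ ε := by
  have hne : {k : ℕ∞ | ∃ T : Finset α, (T.card : ℕ∞) = k ∧ ∀ s ∈ S, ∃ c ∈ T, ρ s c ≤ ε}.Nonempty := by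
    by_contra hcon
    rw [Set.not_nonempty_iff_eq_empty] at hcon
    apply h
    rw [covN, hcon, sInf_empty]
  exact csInf_mem hne

lemma empDist_norm {X : Type*} {N : ℕ} (hN : 1 ≤ N) (x : Fin N → X) (g h : X → ℝ) :
    ‖(WithLp.toLp 2 (fun i => g (x i)) : EuclideanSpace ℝ (Fin N))
      - WithLp.toLp 2 (fun i => h (x i))‖ = Real.sqrt N * empDist x g h := by
  have : (0 : ℝ) < N := by exact_mod_cast hN
  rw [empDist, ← Real.sqrt_mul this.le, EuclideanSpace.norm_eq, ← mul_assoc,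
    mul_one_div_cancel this.ne', one_mul]
  simp

/-- **Empirical Rademacher complexity bound** (Lemma B.1). -/
theorem empirical_rademacher_complexity_bound
    {d N : ℕ} (hd : 1 ≤ d) (hN : 1 ≤ N)
    (Θ : Set (EuclideanSpace ℝ (Fin d))) (hΘne : Θ.Nonempty) (hΘcpt : IsCompact Θ)
    {X : Type*} (x : Fin N → X)
    (f : EuclideanSpace ℝ (Fin d) → X → ℝ)
    (hf01 : ∀ θ x', f θ x' ∈ Set.Icc (0 : ℝ) 1)
    (hfcont : ∀ i : Fin N, ContinuousOn (fun θ => f θ (x i)) Θ)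
    (C' : ℝ) (hC'0 : 0 ≤ C')
    (hcov : ∀ ε ∈ Set.Ioc (0 : ℝ) 1,
      covN (empDist x) ε {g : X → ℝ | ∃ θ ∈ Θ, g = f θ} ≠ ⊤ ∧
      Real.log ((covN (empDist x) ε {g : X → ℝ | ∃ θ ∈ Θ, g = f θ}).toNat : ℝ)
        ≤ C' - d * Real.log ε) :
    (2 ^ N : ℝ)⁻¹ *
        ∑ σ : Fin N → Bool,
          sSup {s : ℝ | ∃ θ ∈ Θ,
            s = (1 / (N : ℝ)) * ∑ i, (if σ i then (1 : ℝ) else -1) * f θ (x i)}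
      ≤ 6 * Real.sqrt (Real.pi * (d : ℝ)) * Real.exp (C' / (d : ℝ)) / Real.sqrt (N : ℝ) := by
  classical
  have hN0 : (0 : ℝ) < N := by exact_mod_cast hN
  have hd1 : (1 : ℝ) ≤ d := by exact_mod_cast hd
  have hsN : 0 < Real.sqrt N := Real.sqrt_pos.2 hN0
  have hsNN : Real.sqrt N * Real.sqrt N = N := Real.mul_self_sqrt hN0.le
  set v : (X → ℝ) → EuclideanSpace ℝ (Fin N) := fun g => WithLp.toLp 2 (fun i => g (x i)) with hv
  set U : Set (EuclideanSpace ℝ (Fin N)) := (fun θ => v (f θ)) '' Θ with hU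
  have key : ∀ j : ℕ, ∃ T : Finset (EuclideanSpace ℝ (Fin N)), (j = 0 → T = {0}) ∧
      (T.card : ℝ) ≤ Real.exp (C' + d * (j * Real.log 2)) ∧
      ∀ u ∈ U, ∃ c ∈ T, ‖u - c‖ ≤ Real.sqrt N * (1 / 2) ^ j := by
    intro j
    rcases Nat.eq_zero_or_pos j with rfl | hj
    · refine ⟨{0}, fun _ => rfl, ?_, ?_⟩
      · simpa using hC'0
      · rintro _ ⟨θ, hθ, rfl⟩
        refine ⟨0, by simp, ?_⟩
        rw [sub_zero, pow_zero, mul_one, EuclideanSpace.norm_eq]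
        apply Real.sqrt_le_sqrt
        calc _ ≤ ∑ i : Fin N, (1 : ℝ) := by
              apply Finset.sum_le_sum
              intro i _
              obtain ⟨h0, h1⟩ := hf01 θ (x i)
              simp only [hv, Real.norm_eq_abs, sq_abs]
              exact pow_le_one₀ h0 h1
          _ = N := by simp
    · have hε : ((1 : ℝ) / 2) ^ j ∈ Set.Ioc (0 : ℝ) 1 :=
        ⟨by positivity, pow_le_one₀ (by norm_num) (by norm_num)⟩
      obtain ⟨h1, h2⟩ := hcov _ hε
      obtain ⟨T, hTc, hT⟩ := exists_cover _ _ _ h1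
      rw [← hTc] at h2
      have hne : T.Nonempty := by
        obtain ⟨θ, hθ⟩ := hΘne
        obtain ⟨c, hc, _⟩ := hT (f θ) ⟨θ, hθ, rfl⟩
        exact ⟨c, hc⟩
      refine ⟨T.image v, fun h => absurd h hj.ne', ?_, ?_⟩
      · have h3 : ((T.image v).card : ℝ) ≤ T.card := by exact_mod_cast Finset.card_image_le
        have h4 : (0 : ℝ) < T.card := by exact_mod_cast hne.card_pos
        refine h3.trans ?_
        rw [← Real.log_le_iff_le_exp h4]
        simp only [ENat.toNat_coe, Real.log_pow, one_div, Real.log_inv] at h2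
        linarith
      · rintro _ ⟨θ, hθ, rfl⟩
        obtain ⟨c, hc, hcd⟩ := hT (f θ) ⟨θ, hθ, rfl⟩
        refine ⟨v c, Finset.mem_image_of_mem _ hc, ?_⟩
        simp only [hv]
        rw [empDist_norm hN]
        gcongr
  choose T hT0 hTc hT using key
  obtain ⟨J, hJ⟩ := exists_pow_lt_of_lt_one (show (0 : ℝ) < 1 / Real.sqrt N by positivity)
    (show (1 / 2 : ℝ) < 1 by norm_num)
  obtain ⟨B, hB, hBs⟩ := chain hd U C' (Real.sqrt N) hC'0 hsN T (hT0 0 rfl) hTc hT J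
  have hsup : ∀ σ : Fin N → Bool, sSup {s : ℝ | ∃ θ ∈ Θ,
            s = (1 / (N : ℝ)) * ∑ i, (if σ i then (1 : ℝ) else -1) * f θ (x i)}
      ≤ (1 / (N : ℝ)) * (B σ + Real.sqrt N) := by
    intro σ
    apply csSup_le
    · obtain ⟨θ, hθ⟩ := hΘne
      exact ⟨_, θ, hθ, rfl⟩
    · rintro _ ⟨θ, hθ, rfl⟩
      have hu : v (f θ) ∈ U := ⟨θ, hθ, rfl⟩
      obtain ⟨c, hc, hcd⟩ := hT J _ hu
      have h1 := hB σ _ hu c hc hcd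
      have h2 := sgnSum_le σ (v (f θ) - c)
      rw [sgnSum_sub] at h2
      have h3 : Real.sqrt N * ‖v (f θ) - c‖ ≤ Real.sqrt N := by
        have : ‖v (f θ) - c‖ ≤ 1 := by
          refine hcd.trans ?_
          refine (mul_le_mul_of_nonneg_left hJ.le hsN.le).trans ?_
          rw [mul_one_div_cancel hsN.ne']
        nlinarith
      have h4 : ∑ i, (if σ i then (1 : ℝ) else -1) * f θ (x i) = sgnSum σ (v (f θ)) := rfl
      rw [h4]
      gcongr
      linarith
  set A := Real.exp (C' / d) with hA
  have hA1 : 1 ≤ A := Real.one_le_exp (by positivity)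
  have hsd : 1 ≤ Real.sqrt d := Real.one_le_sqrt.2 hd1
  have hpi : (1.5 : ℝ) ≤ Real.sqrt Real.pi := by
    apply Real.le_sqrt_of_sq_le
    linarith [Real.pi_gt_three]
  have hBs2 : ∑ σ, B σ ≤ 2 ^ N * (3 * Real.sqrt N * Real.sqrt d * (A + 1.4)) := by
    refine hBs.trans ?_
    have hp : (0 : ℝ) ≤ (1 / 2) ^ J := by positivity
    have : A * (1 - (1 / 2) ^ J) + 0.7 * (2 - (J + 2) * (1 / 2) ^ J) ≤ A + 1.4 := by
      have h1 : 0 ≤ A * (1 / 2) ^ J := by positivity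
      have h2 : 0 ≤ ((J : ℝ) + 2) * (1 / 2) ^ J := by positivity
      linarith
    gcongr
  have hAd : 1 ≤ Real.sqrt d * A := one_le_mul_of_one_le_of_one_le hsd hA1
  calc _ ≤ (2 ^ N : ℝ)⁻¹ * ∑ σ : Fin N → Bool, (1 / (N : ℝ)) * (B σ + Real.sqrt N) := by
        gcongr with σ
        exact hsup σ
    _ = (2 ^ N : ℝ)⁻¹ * ((1 / (N : ℝ)) * (∑ σ, B σ + 2 ^ N * Real.sqrt N)) := by
        rw [← Finset.mul_sum, Finset.sum_add_distrib]
        simp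
    _ ≤ (2 ^ N : ℝ)⁻¹ * ((1 / (N : ℝ)) * (2 ^ N * (3 * Real.sqrt N * Real.sqrt d * (A + 1.4))
          + 2 ^ N * Real.sqrt N)) := by gcongr
    _ = (3 * Real.sqrt d * (A + 1.4) + 1) / Real.sqrt N := by
        have h1N : 1 / (N : ℝ) = 1 / (Real.sqrt N * Real.sqrt N) := by rw [hsNN]
        rw [h1N]
        field_simp
    _ ≤ _ := by
        gcongr
        rw [Real.sqrt_mul Real.pi_pos.le]
        have h1 : Real.sqrt d * 1 ≤ Real.sqrt d * A := by gcongr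
        have h2 : 1.5 * (Real.sqrt d * A) ≤ Real.sqrt Real.pi * (Real.sqrt d * A) := by gcongr
        linarith
end
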